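/- Let q ∈ ℝ with 0 < q < 1, and let a, b ∈ ℝ with a > 0. Then Σ_{i,j≥0} q^{a(i−j)²+b(i−j)+j(j+1)/2} / ((q;q)_i (q;q)_j) = (−q;q)_∞ · Σ_{i,j≥0} q^{a(i−j)²+b(i−j)+j(j+1)/2+ij} / ((q;q)_i (q²;q²)_j). -/

import Mathlib

open scoped BigOperators

/-- The finite q-Pochhammer symbol `(a;q)_n = ∏_{k=0}^{n-1} (1 - a q^k)` (real version). -/
noncomputable def qPochR (a q : ℝ) (n : ℕ) : ℝ := ∏ k ∈ Finset.range n, (1 - a * q ^ k)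

/-- The infinite q-Pochhammer symbol `(a;q)_∞ = ∏_{k=0}^{∞} (1 - a q^k)` (real version). -/
noncomputable def qPochInfR (a q : ℝ) : ℝ := ∏' k : ℕ, (1 - a * q ^ k)

lemma qPochR_succ (a q : ℝ) (n : ℕ) :
    qPochR a q (n + 1) = qPochR a q n * (1 - a * q ^ n) :=
  Finset.prod_range_succ _ _

lemma qPochR_self_pos {q : ℝ} (hq0 : 0 < q) (hq1 : q < 1) (n : ℕ) : 0 < qPochR q q n := by
  refine Finset.prod_pos fun k _ => ?_
  have : q ^ (k + 1) < 1 := pow_lt_one₀ hq0.le hq1 (by omega)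
  rw [pow_succ'] at this
  linarith

lemma one_le_qPochR_neg {q : ℝ} (hq0 : 0 < q) (n : ℕ) : 1 ≤ qPochR (-q) q n := by
  induction n with
  | zero => simp [qPochR]
  | succ n ih =>
    rw [qPochR_succ]
    have : 0 < q * q ^ n := by positivity
    nlinarith

lemma qPochR_mul_neg (q : ℝ) (n : ℕ) :
    qPochR q q n * qPochR (-q) q n = qPochR (q ^ 2) (q ^ 2) n := by
  simp only [qPochR, ← Finset.prod_mul_distrib]
  refine Finset.prod_congr rfl fun k _ => ?_
  ring

/-- The general term of Euler's expansion of `(cq;q)_∞`. -/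
noncomputable def eulerTerm (q c : ℝ) (k : ℕ) : ℝ :=
  (-c) ^ k * q ^ (k + 1).choose 2 / qPochR q q k

/-- Euler's series, the power series expansion of `(cq;q)_∞` in `c`. -/
noncomputable def eulerSeries (q c : ℝ) : ℝ := ∑' k, eulerTerm q c k

lemma choose_two_add_add_one (j k : ℕ) :
    (j + k + 1).choose 2 = (j + 1).choose 2 + (k + 1).choose 2 + j * k := by
  induction k with
  | zero => simp
  | succ k ih =>
    rw [← add_assoc j, Nat.choose_succ_succ' (j + k + 1) 1, Nat.choose_succ_succ' (k + 1) 1, ih,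
      Nat.choose_one_right, Nat.choose_one_right]
    ring

lemma pow_choose_succ (q : ℝ) (k : ℕ) :
    q ^ (k + 2).choose 2 = q ^ (k + 1).choose 2 * q ^ (k + 1) := by
  rw [Nat.choose_succ_succ' (k + 1) 1, Nat.choose_one_right, pow_add, mul_comm]

lemma eulerTerm_succ (q c : ℝ) (k : ℕ) :
    eulerTerm q c (k + 1) = eulerTerm q c k * (-c * q ^ (k + 1) / (1 - q ^ (k + 1))) := by
  rw [eulerTerm, eulerTerm, qPochR_succ, pow_choose_succ, ← pow_succ' q k, div_mul_div_comm]
  ring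

lemma eulerTerm_mul_pow (q c x : ℝ) (k : ℕ) :
    eulerTerm q (c * x) k = eulerTerm q c k * x ^ k := by
  rw [eulerTerm, eulerTerm, neg_mul_eq_neg_mul, mul_pow]
  ring

lemma norm_eulerTerm {q : ℝ} (hq0 : 0 < q) (hq1 : q < 1) (c : ℝ) (k : ℕ) :
    ‖eulerTerm q c k‖ = |c| ^ k * q ^ (k + 1).choose 2 / qPochR q q k := by
  have := qPochR_self_pos hq0 hq1 k
  simp [eulerTerm, abs_of_pos hq0, abs_of_pos this]

lemma summable_eulerTerm {q : ℝ} (hq0 : 0 < q) (hq1 : q < 1) (c : ℝ) :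
    Summable (eulerTerm q c) := by
  refine summable_of_ratio_norm_eventually_le (r := 1 / 2) (by norm_num) ?_
  have hp : Filter.Tendsto (fun k : ℕ => q ^ (k + 1)) Filter.atTop (nhds 0) :=
    (tendsto_pow_atTop_nhds_zero_of_lt_one hq0.le hq1).comp (Filter.tendsto_add_atTop_nat 1)
  have hr : Filter.Tendsto (fun k : ℕ => ‖-c * q ^ (k + 1) / (1 - q ^ (k + 1))‖)
      Filter.atTop (nhds 0) := by
    simpa using ((hp.const_mul (-c)).div (hp.const_sub 1) (by norm_num)).norm
  filter_upwards [hr.eventually_lt_const (show (0 : ℝ) < 1 / 2 by norm_num)] with k hk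
  rw [eulerTerm_succ, norm_mul, mul_comm]
  gcongr

lemma eulerSeries_eq_mul {q : ℝ} (hq0 : 0 < q) (hq1 : q < 1) (c : ℝ) :
    eulerSeries q c = (1 - c * q) * eulerSeries q (c * q) := by
  have h1 := summable_eulerTerm hq0 hq1 c
  have h2 := summable_eulerTerm hq0 hq1 (c * q)
  have key : eulerSeries q c - eulerSeries q (c * q) = -(c * q) * eulerSeries q (c * q) := by
    rw [eulerSeries, eulerSeries, ← h1.tsum_sub h2, (h1.sub h2).tsum_eq_zero_add, ← tsum_mul_left]
    have h0 : eulerTerm q c 0 - eulerTerm q (c * q) 0 = 0 := by simp [eulerTerm]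
    rw [h0, zero_add]
    refine tsum_congr fun k => ?_
    have hk : 1 - q ^ (k + 1) ≠ 0 := (sub_pos.2 (pow_lt_one₀ hq0.le hq1 (by omega))).ne'
    rw [eulerTerm_mul_pow, eulerTerm_mul_pow, eulerTerm_succ]
    field_simp
    ring
  linarith

lemma eulerSeries_eq_qPochR_mul {q : ℝ} (hq0 : 0 < q) (hq1 : q < 1) (c : ℝ) (n : ℕ) :
    eulerSeries q c = qPochR (c * q) q n * eulerSeries q (c * q ^ n) := by
  induction n with
  | zero => simp [qPochR]
  | succ n ih =>
    rw [ih, qPochR_succ, eulerSeries_eq_mul hq0 hq1 (c * q ^ n)]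
    ring_nf

lemma tendsto_eulerSeries_mul_pow {q : ℝ} (hq0 : 0 < q) (hq1 : q < 1) (c : ℝ) :
    Filter.Tendsto (fun n : ℕ => eulerSeries q (c * q ^ n)) Filter.atTop (nhds 1) := by
  have h0 : ∑' k, eulerTerm q 0 k = 1 := by
    rw [tsum_eq_single 0 fun k hk => by simp [eulerTerm, hk]]
    simp [eulerTerm, qPochR]
  rw [← h0]
  refine tendsto_tsum_of_dominated_convergence (summable_eulerTerm hq0 hq1 c).norm (fun k => ?_)
    (Filter.Eventually.of_forall fun n k => ?_)
  · have hc : Continuous fun x => eulerTerm q x k := by unfold eulerTerm; fun_prop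
    refine (hc.tendsto 0).comp ?_
    simpa using (tendsto_pow_atTop_nhds_zero_of_lt_one hq0.le hq1).const_mul c
  · rw [eulerTerm_mul_pow, norm_mul]
    refine mul_le_of_le_one_right (norm_nonneg _) ?_
    rw [norm_pow, norm_pow, Real.norm_of_nonneg hq0.le]
    exact pow_le_one₀ (by positivity) (pow_le_one₀ hq0.le hq1.le)

lemma eulerSeries_one_ne_zero {q : ℝ} (hq0 : 0 < q) (hq1 : q < 1) : eulerSeries q 1 ≠ 0 := by
  obtain ⟨n, hn⟩ := ((tendsto_eulerSeries_mul_pow hq0 hq1 1).eventually_ne one_ne_zero).exists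
  rw [eulerSeries_eq_qPochR_mul hq0 hq1 1 n, one_mul q]
  exact mul_ne_zero (qPochR_self_pos hq0 hq1 n).ne' hn

lemma qPochInfR_neg_eq_eulerSeries {q : ℝ} (hq0 : 0 < q) (hq1 : q < 1) :
    qPochInfR (-q) q = eulerSeries q (-1) := by
  have hm : Multipliable fun k : ℕ => 1 - -q * q ^ k := by
    simpa [sub_eq_add_neg] using
      Real.multipliable_one_add_of_summable ((summable_geometric_of_lt_one hq0.le hq1).mul_left q)
  have h1 : Filter.Tendsto (fun n => qPochR (-q) q n) Filter.atTop (nhds (qPochInfR (-q) q)) :=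
    hm.hasProd.tendsto_prod_nat
  have h2 := h1.mul (tendsto_eulerSeries_mul_pow hq0 hq1 (-1))
  rw [mul_one] at h2
  refine tendsto_nhds_unique h2 (tendsto_const_nhds.congr fun n => ?_)
  simpa using eulerSeries_eq_qPochR_mul hq0 hq1 (-1) n

/-- The function `n ↦ 1 / (q;q)_n` on `ℤ`, which vanishes for negative `n`. -/
noncomputable def invQPoch (q : ℝ) : ℤ → ℝ
  | Int.ofNat n => (qPochR q q n)⁻¹
  | Int.negSucc _ => 0

lemma invQPoch_natCast (q : ℝ) (n : ℕ) : invQPoch q n = (qPochR q q n)⁻¹ := rfl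

lemma invQPoch_of_neg (q : ℝ) {n : ℤ} (hn : n < 0) : invQPoch q n = 0 := by
  cases n with
  | ofNat n => simp at hn; omega
  | negSucc n => rfl

lemma invQPoch_sub_one {q : ℝ} (hq0 : 0 < q) (hq1 : q < 1) (n : ℤ) :
    invQPoch q (n - 1) = (1 - q ^ n) * invQPoch q n := by
  rcases lt_trichotomy n 0 with hn | rfl | hn
  · rw [invQPoch_of_neg q hn, invQPoch_of_neg q (by omega), mul_zero]
  · rw [invQPoch_of_neg q (by omega)]; simp
  · obtain ⟨m, rfl⟩ : ∃ m : ℕ, n = (m + 1 : ℕ) := ⟨(n - 1).toNat, by omega⟩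
    have hm : ((m + 1 : ℕ) : ℤ) - 1 = (m : ℕ) := by push_cast; ring
    have h1 : 1 - q ^ (m + 1) ≠ 0 := (sub_pos.2 (pow_lt_one₀ hq0.le hq1 (by omega))).ne'
    rw [hm, invQPoch_natCast, invQPoch_natCast, qPochR_succ, zpow_natCast, ← pow_succ', mul_inv,
      mul_left_comm, mul_inv_cancel₀ h1, mul_one]

lemma eulerSeries_zpow {q : ℝ} (hq0 : 0 < q) (hq1 : q < 1) (n : ℤ) :
    eulerSeries q (q ^ n) = eulerSeries q 1 * invQPoch q n := by
  cases n with
  | ofNat n =>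
    have h := eulerSeries_eq_qPochR_mul hq0 hq1 1 n
    have := (qPochR_self_pos hq0 hq1 n).ne'
    rw [one_mul, one_mul] at h
    rw [Int.ofNat_eq_natCast, invQPoch_natCast, zpow_natCast, h]
    field_simp
  | negSucc n =>
    rw [eulerSeries_eq_qPochR_mul hq0 hq1 _ (n + 1), qPochR_succ, zpow_negSucc]
    have : (q ^ (n + 1))⁻¹ * q * q ^ n = 1 := by
      rw [mul_assoc, ← pow_succ', inv_mul_cancel₀ (by positivity)]
    rw [this]
    simp [invQPoch]

lemma invQPoch_nonneg {q : ℝ} (hq0 : 0 < q) (hq1 : q < 1) (n : ℤ) : 0 ≤ invQPoch q n := by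
  cases n with
  | ofNat n => exact (inv_pos.2 (qPochR_self_pos hq0 hq1 n)).le
  | negSucc n => exact le_rfl

lemma exists_invQPoch_le {q : ℝ} (hq0 : 0 < q) (hq1 : q < 1) : ∃ C, ∀ n, invQPoch q n ≤ C := by
  obtain ⟨C, hC⟩ := (tendsto_eulerSeries_mul_pow hq0 hq1 1).norm.bddAbove_range
  have hE := eulerSeries_one_ne_zero hq0 hq1
  have hC0 : 0 ≤ C := (norm_nonneg _).trans (hC ⟨0, rfl⟩)
  refine ⟨C / ‖eulerSeries q 1‖, fun n => ?_⟩
  cases n with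
  | ofNat n =>
    have h : ‖eulerSeries q (1 * q ^ n)‖ ≤ C := hC ⟨n, rfl⟩
    rw [le_div_iff₀ (norm_pos_iff.2 hE)]
    refine le_trans (le_of_eq ?_) h
    rw [one_mul, ← zpow_natCast, eulerSeries_zpow hq0 hq1, norm_mul,
      Real.norm_of_nonneg (invQPoch_nonneg hq0 hq1 _), mul_comm]
    rfl
  | negSucc n => exact div_nonneg hC0 (norm_nonneg _)

/-- The coefficient identity behind `(zq;q²)_∞ / (z;q)_∞ = 1 / (z;q²)_∞`. -/
lemma sum_qPochR_sq {q : ℝ} (hq0 : 0 < q) (hq1 : q < 1) (m : ℕ) :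
    ∑ j ∈ Finset.range (m + 1),
        (-1) ^ j * q ^ j ^ 2 / qPochR (q ^ 2) (q ^ 2) j * invQPoch q ((m : ℤ) - j) =
      (qPochR (q ^ 2) (q ^ 2) m)⁻¹ := by
  have hs : ∀ k : ℕ, 1 - q ^ 2 * (q ^ 2) ^ k ≠ 0 := fun k => by
    rw [← pow_succ', ← pow_mul]
    exact (sub_pos.2 (pow_lt_one₀ hq0.le hq1 (by omega))).ne'
  set x : ℕ → ℝ := fun j => (-1) ^ j * q ^ j ^ 2 / qPochR (q ^ 2) (q ^ 2) j with hx
  have hx_succ (j : ℕ) : (1 - q ^ (2 * (j + 1))) * x (j + 1) = -q ^ (2 * j + 1) * x j := by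
    have h : 1 - q ^ (2 * (j + 1)) ≠ 0 := by
      have := hs j
      rwa [← pow_succ', ← pow_mul] at this
    simp only [hx]
    rw [qPochR_succ, ← pow_succ', ← pow_mul, mul_div_assoc', mul_comm (qPochR _ _ _),
      mul_div_mul_left _ _ h]
    ring
  induction m with
  | zero => simp [qPochR, show invQPoch q 0 = 1 by simpa [qPochR] using invQPoch_natCast q 0]
  | succ m ih =>
    have hm := hs m
    rw [← pow_succ', ← pow_mul] at hm
    rw [qPochR_succ, ← pow_succ', ← pow_mul, mul_inv, ← ih, eq_mul_inv_iff_mul_eq₀ hm]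
    have hlast : ∑ j ∈ Finset.range (m + 1), x j * invQPoch q ((m : ℤ) - j) =
        ∑ j ∈ Finset.range (m + 2), x j * invQPoch q ((m : ℤ) - j) := by
      rw [Finset.sum_range_succ _ (m + 1), invQPoch_of_neg q (by push_cast; omega), mul_zero,
        add_zero]
    rw [hlast, Finset.sum_mul, ← sub_eq_zero, ← Finset.sum_sub_distrib]
    set G : ℕ → ℝ := fun j => (1 - q ^ (2 * j)) * x j *
      (invQPoch q ((m : ℤ) - j) - invQPoch q ((m : ℤ) + 1 - j)) with hG
    rw [Finset.sum_congr rfl (g := fun j => G (j + 1) - G j), Finset.sum_range_sub]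
    · simp only [hG]
      rw [invQPoch_of_neg q (by push_cast; omega), invQPoch_of_neg q (by push_cast; omega)]
      simp
    · intro j hj
      have hj' : j ≤ m + 1 := by simpa [Nat.lt_succ_iff] using hj
      obtain ⟨d, hd⟩ := Nat.exists_eq_add_of_le hj'
      have e1 := invQPoch_sub_one hq0 hq1 ((m : ℤ) + 1 - j)
      have e2 := invQPoch_sub_one hq0 hq1 ((m : ℤ) - j)
      have e3 : (m : ℤ) + 1 - j - 1 = m - j := by ring
      have e4 : (m : ℤ) - j - 1 = m - (j + 1 : ℕ) := by push_cast; ring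
      have e5 : (m : ℤ) + 1 - (j + 1 : ℕ) = m - j := by push_cast; ring
      have e6 : (m : ℤ) - j = d - 1 := by omega
      have e7 : (m : ℤ) + 1 - j = d := by omega
      simp only [hG]
      rw [hx_succ, e5, ← e4, e2]
      rw [e3] at e1
      push_cast
      rw [e1, e6, e7, zpow_sub_one₀ hq0.ne', zpow_natCast,
        show q ^ (2 * (m + 1)) = (q ^ j) ^ 2 * (q ^ d) ^ 2 by rw [hd]; ring,
        show q ^ (2 * j) = (q ^ j) ^ 2 by ring, show q ^ (2 * j + 1) = (q ^ j) ^ 2 * q by ring]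
      field_simp
      ring

lemma summable_eulerTerm_mul {q : ℝ} (hq0 : 0 < q) (hq1 : q < 1) (c d : ℝ) :
    Summable fun p : ℕ × ℕ => ‖eulerTerm q c p.1‖ * ‖eulerTerm q d p.2‖ :=
  (summable_eulerTerm hq0 hq1 c).norm.mul_of_nonneg (summable_eulerTerm hq0 hq1 d).norm
    (fun _ => norm_nonneg _) fun _ => norm_nonneg _

lemma eulerSeries_neg_pow {q : ℝ} (hq0 : 0 < q) (hq1 : q < 1) (k : ℕ) :
    eulerSeries q (-1 * q ^ k) = eulerSeries q (-1) / qPochR (-q) q k := by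
  have h := eulerSeries_eq_qPochR_mul hq0 hq1 (-1) k
  have := (one_pos.trans_le (one_le_qPochR_neg hq0 k)).ne'
  rw [neg_one_mul q] at h
  rw [h]
  field_simp

lemma tsum_eulerTerm_mul_eulerSeries {q : ℝ} (hq0 : 0 < q) (hq1 : q < 1) (c : ℝ) :
    ∑' j, eulerTerm q (-1) j * eulerSeries q (c * q ^ j) =
      eulerSeries q (-1) * ∑' k, eulerTerm q c k / qPochR (-q) q k := by
  have hsum : Summable (Function.uncurry fun j k : ℕ =>
      eulerTerm q (-1) j * eulerTerm q (c * q ^ j) k) := by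
    refine (summable_eulerTerm_mul hq0 hq1 (-1) c).of_norm_bounded fun ⟨j, k⟩ => ?_
    simp only [Function.uncurry]
    rw [eulerTerm_mul_pow, norm_mul, norm_mul]
    refine mul_le_mul_of_nonneg_left (mul_le_of_le_one_right (norm_nonneg _) ?_) (norm_nonneg _)
    rw [Real.norm_of_nonneg (by positivity)]
    exact pow_le_one₀ (by positivity) (pow_le_one₀ hq0.le hq1.le)
  simp only [eulerSeries, ← tsum_mul_left]
  rw [← hsum.tsum_comm]
  refine tsum_congr fun k => ?_
  rw [← eulerSeries, mul_div_assoc', mul_comm _ (eulerTerm q c k), mul_div_assoc,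
    ← eulerSeries_neg_pow hq0 hq1 k, eulerSeries, ← tsum_mul_left]
  refine tsum_congr fun j => ?_
  rw [eulerTerm_mul_pow, eulerTerm_mul_pow]
  ring

lemma tsum_pow_sq_mul_eulerSeries {q : ℝ} (hq0 : 0 < q) (hq1 : q < 1) (c : ℝ) :
    ∑' j, eulerTerm q (-1) j / qPochR (-q) q j * (c ^ j * q ^ j ^ 2) * eulerSeries q (c * q ^ j) =
      ∑' k, eulerTerm q c k / qPochR (-q) q k := by
  set f : ℕ × ℕ → ℝ := fun p => eulerTerm q (-1) p.1 / qPochR (-q) q p.1 *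
    (c ^ p.1 * q ^ p.1 ^ 2) * eulerTerm q (c * q ^ p.1) p.2 with hf
  have hsum : Summable f := by
    refine (summable_eulerTerm_mul hq0 hq1 c c).of_norm_bounded fun ⟨j, k⟩ => ?_
    simp only [hf]
    rw [eulerTerm_mul_pow, norm_mul, norm_mul _ ((q ^ j) ^ k)]
    have h1 : ‖(q ^ j) ^ k‖ ≤ 1 := by
      rw [Real.norm_of_nonneg (by positivity)]
      exact pow_le_one₀ (by positivity) (pow_le_one₀ hq0.le hq1.le)
    have h2 : ‖eulerTerm q (-1) j / qPochR (-q) q j * (c ^ j * q ^ j ^ 2)‖ ≤ ‖eulerTerm q c j‖ := by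
      have h3 : ‖q ^ j ^ 2 / qPochR (-q) q j‖ ≤ 1 := by
        have := one_le_qPochR_neg hq0 j
        rw [Real.norm_of_nonneg (by positivity)]
        exact div_le_one_of_le₀ ((pow_le_one₀ hq0.le hq1.le).trans this) (by positivity)
      calc _ = ‖eulerTerm q (-1 * c) j * (q ^ j ^ 2 / qPochR (-q) q j)‖ := by
              rw [eulerTerm_mul_pow]; ring_nf
        _ ≤ ‖eulerTerm q (-1 * c) j‖ := by
              rw [norm_mul]; exact mul_le_of_le_one_right (norm_nonneg _) h3
        _ = _ := by simp [norm_eulerTerm hq0 hq1]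
    exact mul_le_mul h2 (mul_le_of_le_one_right (norm_nonneg _) h1) (by positivity) (by positivity)
  have h1 : ∑' j, eulerTerm q (-1) j / qPochR (-q) q j * (c ^ j * q ^ j ^ 2) *
      eulerSeries q (c * q ^ j) = ∑' p, f p := by
    rw [hsum.tsum_prod]
    simp only [hf, tsum_mul_left, eulerSeries]
  rw [h1, ← Finset.HasAntidiagonal.sigmaAntidiagonalEquivProd.tsum_eq f,
    Summable.tsum_sigma (f := fun p => f (Finset.HasAntidiagonal.sigmaAntidiagonalEquivProd p))
      (Finset.HasAntidiagonal.sigmaAntidiagonalEquivProd.summable_iff.2 hsum)]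
  refine tsum_congr fun m => ?_
  have hfin : eulerTerm q c m / qPochR (-q) q m =
      (-c) ^ m * q ^ (m + 1).choose 2 * (qPochR (q ^ 2) (q ^ 2) m)⁻¹ := by
    rw [eulerTerm, div_div, qPochR_mul_neg, div_eq_mul_inv]
  have hanti : ∑' p : Finset.HasAntidiagonal.antidiagonal m,
      f (Finset.HasAntidiagonal.sigmaAntidiagonalEquivProd ⟨m, p⟩) =
      ∑ p ∈ Finset.HasAntidiagonal.antidiagonal m, f p := by
    rw [tsum_fintype]
    exact Finset.sum_coe_sort (Finset.HasAntidiagonal.antidiagonal m) f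
  rw [hanti, Finset.Nat.sum_antidiagonal_eq_sum_range_succ_mk, hfin, ← sum_qPochR_sq hq0 hq1,
    Finset.mul_sum]
  refine Finset.sum_congr rfl fun j hj => ?_
  obtain ⟨k, rfl⟩ := Nat.exists_eq_add_of_le (Nat.lt_succ_iff.1 (Finset.mem_range.1 hj))
  have hc : ((j + k : ℕ) : ℤ) - j = (k : ℕ) := by push_cast; ring
  simp only [hf]
  rw [hc, invQPoch_natCast, choose_two_add_add_one, Nat.add_sub_cancel_left, eulerTerm, eulerTerm,
    ← qPochR_mul_neg]
  have h1 : (-c) ^ j = (-1) ^ j * c ^ j := by rw [← mul_pow]; ring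
  have h2 : (-(c * q ^ j)) ^ k = (-c) ^ k * q ^ (j * k) := by rw [pow_mul, ← mul_pow]; ring
  rw [pow_add (-c), h1, h2, neg_neg, one_pow, pow_add, pow_add]
  have h3 : ((-1 : ℝ) ^ j) * (-1) ^ j = 1 := by rw [← mul_pow]; simp
  linear_combination (-(c ^ j * (-c) ^ k * q ^ (j + 1).choose 2 * q ^ (k + 1).choose 2 *
    q ^ (j * k) * q ^ j ^ 2 * (qPochR q q j)⁻¹ * (qPochR (-q) q j)⁻¹ * (qPochR q q k)⁻¹)) * h3

lemma eulerTerm_neg_one_nonneg {q : ℝ} (hq0 : 0 < q) (hq1 : q < 1) (j : ℕ) :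
    0 ≤ eulerTerm q (-1) j := by
  have := qPochR_self_pos hq0 hq1 j
  rw [eulerTerm, neg_neg]
  positivity

lemma tsum_eulerTerm_mul_invQPoch {q : ℝ} (hq0 : 0 < q) (hq1 : q < 1) (n : ℤ) :
    ∑' j : ℕ, eulerTerm q (-1) j * invQPoch q (n + j) =
      qPochInfR (-q) q * ∑' j : ℕ, eulerTerm q (-1) j / qPochR (-q) q j *
        ((q ^ n) ^ j * q ^ j ^ 2) * invQPoch q (n + j) := by
  have hE (j : ℕ) : eulerSeries q (q ^ n * q ^ j) = eulerSeries q 1 * invQPoch q (n + j) := by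
    rw [← eulerSeries_zpow hq0 hq1, zpow_add₀ hq0.ne', zpow_natCast]
  have h := tsum_eulerTerm_mul_eulerSeries hq0 hq1 (q ^ n)
  rw [← tsum_pow_sq_mul_eulerSeries hq0 hq1, ← qPochInfR_neg_eq_eulerSeries hq0 hq1] at h
  simp only [hE, mul_left_comm _ (eulerSeries q 1), tsum_mul_left] at h
  exact mul_left_cancel₀ (eulerSeries_one_ne_zero hq0 hq1) h

lemma summable_nat_rpow_quadratic {q a : ℝ} (hq0 : 0 < q) (hq1 : q < 1) (ha : 0 < a) (b : ℝ) :
    Summable fun n : ℕ => q ^ (a * (n : ℝ) ^ 2 + b * n) := by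
  refine summable_of_ratio_norm_eventually_le (r := 1 / 2) (by norm_num) ?_
  have hr : Filter.Tendsto (fun n : ℕ => (q ^ (2 * a)) ^ n * q ^ (a + b))
      Filter.atTop (nhds 0) := by
    simpa using (tendsto_pow_atTop_nhds_zero_of_lt_one (Real.rpow_nonneg hq0.le _)
      (Real.rpow_lt_one hq0.le hq1 (by positivity : 0 < 2 * a))).mul_const (q ^ (a + b))
  filter_upwards [hr.eventually_le_const (show (0 : ℝ) < 1 / 2 by norm_num)] with n hn
  have hstep : q ^ (a * ((n + 1 : ℕ) : ℝ) ^ 2 + b * (n + 1 : ℕ)) =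
      (q ^ (2 * a)) ^ n * q ^ (a + b) * q ^ (a * (n : ℝ) ^ 2 + b * n) := by
    rw [← Real.rpow_mul_natCast hq0.le, ← Real.rpow_add hq0, ← Real.rpow_add hq0]
    congr 1
    push_cast
    ring
  rw [hstep, norm_mul, Real.norm_of_nonneg (by positivity : 0 ≤ (q ^ (2 * a)) ^ n * q ^ (a + b))]
  gcongr

lemma summable_int_rpow_quadratic {q a : ℝ} (hq0 : 0 < q) (hq1 : q < 1) (ha : 0 < a) (b : ℝ) :
    Summable fun n : ℤ => q ^ (a * (n : ℝ) ^ 2 + b * n) := by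
  refine Summable.of_nat_of_neg ?_ ?_
  · simpa using summable_nat_rpow_quadratic hq0 hq1 ha b
  · simpa using summable_nat_rpow_quadratic hq0 hq1 ha (-b)

/-- Reindexing a sum over `(i, j) : ℕ × ℕ` by the difference `n = i - j` and `j`. -/
lemma tsum_tsum_sub_eq {F : ℤ × ℕ → ℝ} (hF : Summable F)
    (hF0 : ∀ (n : ℤ) (j : ℕ), n + j < 0 → F (n, j) = 0) :
    ∑' (i : ℕ) (j : ℕ), F ((i : ℤ) - j, j) = ∑' (n : ℤ) (j : ℕ), F (n, j) := by
  have hinj : Function.Injective fun p : ℕ × ℕ => ((p.1 : ℤ) - p.2, p.2) := by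
    rintro ⟨i, j⟩ ⟨i', j'⟩ h
    simp only [Prod.mk.injEq] at h ⊢
    omega
  have hsupp : Function.support F ⊆ Set.range fun p : ℕ × ℕ => ((p.1 : ℤ) - p.2, p.2) := by
    rintro ⟨n, j⟩ h
    have hn : 0 ≤ n + j := not_lt.1 fun hlt => h (hF0 n j hlt)
    exact ⟨((n + j).toNat, j), by simp only [Prod.mk.injEq, and_true]; omega⟩
  rw [← hF.tsum_prod, ← hinj.tsum_eq hsupp]
  exact (Summable.tsum_prod (hF.comp_injective hinj)).symm

lemma summable_rpow_mul_mul {q a : ℝ} (hq0 : 0 < q) (hq1 : q < 1) (ha : 0 < a) (b : ℝ)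
    {h : ℤ → ℕ → ℝ} (h_nonneg : ∀ n j, 0 ≤ h n j)
    (h_le : ∀ n j, h n j ≤ eulerTerm q (-1) j * invQPoch q (n + j)) :
    Summable fun p : ℤ × ℕ => q ^ (a * (p.1 : ℝ) ^ 2 + b * p.1) * h p.1 p.2 := by
  obtain ⟨C, hC⟩ := exists_invQPoch_le hq0 hq1
  have hs := (summable_int_rpow_quadratic hq0 hq1 ha b).mul_of_nonneg
    (summable_eulerTerm hq0 hq1 (-1)) (fun _ => Real.rpow_nonneg hq0.le _)
    (eulerTerm_neg_one_nonneg hq0 hq1)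
  refine (hs.mul_right C).of_nonneg_of_le (fun p => mul_nonneg (by positivity) (h_nonneg _ _))
    fun p => ?_
  rw [mul_assoc]
  refine mul_le_mul_of_nonneg_left ((h_le _ _).trans ?_) (by positivity)
  exact mul_le_mul_of_nonneg_left (hC _) (eulerTerm_neg_one_nonneg hq0 hq1 _)

lemma rpow_triangle (q : ℝ) (j : ℕ) :
    q ^ ((j : ℝ) * ((j : ℝ) + 1) / 2) = q ^ (j + 1).choose 2 := by
  rw [← Real.rpow_natCast, Nat.cast_choose_two]
  congr 1
  push_cast
  ring

/-- Identity (1.8): for `0 < q < 1` and real `a > 0`, `b`,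
`Σ_{i,j≥0} q^{a(i−j)²+b(i−j)+j(j+1)/2} / ((q;q)_i (q;q)_j)
  = (−q;q)_∞ · Σ_{i,j≥0} q^{a(i−j)²+b(i−j)+j(j+1)/2+ij} / ((q;q)_i (q²;q²)_j)`,
where the powers of `q` are real powers. -/
theorem stmt1 (q a b : ℝ) (hq0 : 0 < q) (hq1 : q < 1) (ha : 0 < a) :
    ∑' (i : ℕ) (j : ℕ),
        q ^ (a * ((i : ℝ) - (j : ℝ)) ^ 2 + b * ((i : ℝ) - (j : ℝ)) + (j : ℝ) * ((j : ℝ) + 1) / 2) /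
          (qPochR q q i * qPochR q q j)
      = qPochInfR (-q) q *
        ∑' (i : ℕ) (j : ℕ),
          q ^ (a * ((i : ℝ) - (j : ℝ)) ^ 2 + b * ((i : ℝ) - (j : ℝ)) +
                (j : ℝ) * ((j : ℝ) + 1) / 2 + (i : ℝ) * (j : ℝ)) /
            (qPochR q q i * qPochR (q ^ 2) (q ^ 2) j) := by
  set g : ℤ → ℝ := fun n => q ^ (a * (n : ℝ) ^ 2 + b * n) with hg
  set h₁ : ℤ → ℕ → ℝ := fun n j => eulerTerm q (-1) j * invQPoch q (n + j) with hh₁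
  set h₂ : ℤ → ℕ → ℝ := fun n j => eulerTerm q (-1) j / qPochR (-q) q j *
    ((q ^ n) ^ j * q ^ j ^ 2) * invQPoch q (n + j) with hh₂
  have hE := eulerTerm_neg_one_nonneg hq0 hq1
  have hR := invQPoch_nonneg hq0 hq1
  have hP := one_le_qPochR_neg hq0
  have h₁_nonneg (n : ℤ) (j : ℕ) : 0 ≤ h₁ n j := mul_nonneg (hE j) (hR _)
  have h₂_nonneg (n : ℤ) (j : ℕ) : 0 ≤ h₂ n j :=
    mul_nonneg (mul_nonneg (div_nonneg (hE j) (zero_le_one.trans (hP j))) (by positivity)) (hR _)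
  have h₂_le (n : ℤ) (j : ℕ) : h₂ n j ≤ h₁ n j := by
    rcases lt_or_ge (n + j) 0 with hn | hn
    · simp [hh₁, hh₂, invQPoch_of_neg q hn]
    · refine mul_le_mul_of_nonneg_right ?_ (hR _)
      have hpow : (q ^ n) ^ j * q ^ j ^ 2 = q ^ ((n + j).toNat * j) := by
        rw [← zpow_natCast (q ^ n), ← zpow_mul, ← zpow_natCast, ← zpow_add₀ hq0.ne',
          ← zpow_natCast]
        congr 1
        push_cast [Int.toNat_of_nonneg hn]
        ring
      rw [hpow]
      exact (mul_le_of_le_one_right (div_nonneg (hE j) (zero_le_one.trans (hP j)))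
        (pow_le_one₀ hq0.le hq1.le)).trans (div_le_self (hE j) (hP j))
  have hL := tsum_tsum_sub_eq
    (summable_rpow_mul_mul hq0 hq1 ha b h₁_nonneg fun _ _ => le_rfl)
    fun n j hn => by simp [hh₁, invQPoch_of_neg q hn]
  have hRt := tsum_tsum_sub_eq
    (summable_rpow_mul_mul hq0 hq1 ha b h₂_nonneg h₂_le)
    fun n j hn => by simp [hh₂, invQPoch_of_neg q hn]
  have hsplit (i j : ℕ) : invQPoch q ((i : ℤ) - j + j) = (qPochR q q i)⁻¹ := by
    rw [sub_add_cancel, invQPoch_natCast]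
  calc _ = ∑' (i : ℕ) (j : ℕ), g ((i : ℤ) - j) * h₁ ((i : ℤ) - j) j := by
        refine tsum_congr fun i => tsum_congr fun j => ?_
        simp only [hg, hh₁]
        rw [hsplit, Real.rpow_add hq0, rpow_triangle, eulerTerm]
        push_cast
        rw [neg_neg, one_pow, div_eq_mul_inv, mul_inv]
        ring
    _ = ∑' (n : ℤ) (j : ℕ), g n * h₁ n j := hL
    _ = qPochInfR (-q) q * ∑' (n : ℤ) (j : ℕ), g n * h₂ n j := by
        rw [← tsum_mul_left]
        refine tsum_congr fun n => ?_
        rw [tsum_mul_left, tsum_mul_left, tsum_eulerTerm_mul_invQPoch hq0 hq1]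
        ring
    _ = qPochInfR (-q) q * ∑' (i : ℕ) (j : ℕ), g ((i : ℤ) - j) * h₂ ((i : ℤ) - j) j := by
        rw [← hRt]
    _ = _ := by
        congr 1
        refine tsum_congr fun i => tsum_congr fun j => ?_
        have hpow : (q ^ ((i : ℤ) - j)) ^ j * q ^ j ^ 2 = q ^ ((i : ℝ) * j) := by
          rw [zpow_sub₀ hq0.ne', zpow_natCast, zpow_natCast, div_pow, ← pow_mul, ← pow_mul,
            ← sq, div_mul_cancel₀ _ (by positivity), ← Nat.cast_mul, Real.rpow_natCast]
        simp only [hg, hh₂]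
        rw [hsplit, hpow, Real.rpow_add hq0 _ ((i : ℝ) * j),
          Real.rpow_add hq0 _ ((j : ℝ) * (j + 1) / 2),
          rpow_triangle, eulerTerm, ← qPochR_mul_neg]
        push_cast
        rw [neg_neg, one_pow, div_eq_mul_inv _ (_ * _), mul_inv, mul_inv]
        ring
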